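/- arXiv:2210.01343 — 2 statements merged into one kernel-verified Lean document; each statement's English description precedes it below -/
import Mathlib

section
/- For every finite set of context-free languages L₁, …, L_k over the same finite alphabet Σ, there exists a renormalizing nondeterministic stack RNN (RNS-RNN), with parameters allowed to take values in ℝ ∪ {−∞, +∞}, that recognizes the intersection L₁ ∩ ⋯ ∩ L_k: for every string w ∈ Σ*, after reading w followed by the end-of-sequence symbol EOS, the network's MLP output y satisfies y > 1/2 if and only if w ∈ L₁ ∩ ⋯ ∩ L_k. -/
open scoped Classical

/-- Restricted-form PDA transitions: push a symbol on top of the current top symbol,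
replace the top symbol, or pop the top symbol. -/
inductive RTransition (Q Γ : Type) where
  | push (q : Q) (x : Γ) (r : Q) (y : Γ)
  | replace (q : Q) (x : Γ) (r : Q) (y : Γ)
  | pop (q : Q) (x : Γ) (r : Q)
  deriving DecidableEq, Fintype

/-- Apply a restricted transition to a configuration (state, stack with head = top). -/
def RTransition.apply {Q Γ : Type} [DecidableEq Q] [DecidableEq Γ] :
    RTransition Q Γ → Q × List Γ → Option (Q × List Γ)
  | .push q x r y, (q', x' :: s) =>
      if q = q' ∧ x = x' then some (r, y :: x' :: s) else none
  | .replace q x r y, (q', x' :: s) =>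
      if q = q' ∧ x = x' then some (r, y :: s) else none
  | .pop q x r, (q', x' :: s) =>
      if q = q' ∧ x = x' then some (r, s) else none
  | _, (_, []) => none

/-- Execute a run (sequence of transitions) from the initial configuration
(start state `q0`, stack `[⊥]`). -/
def execRun {Q Γ : Type} [DecidableEq Q] [DecidableEq Γ] (q0 : Q) (bot : Γ)
    (π : List (RTransition Q Γ)) : Option (Q × List Γ) :=
  π.foldl (fun c τ => c.bind τ.apply) (some (q0, [bot]))

/-- The run `π` is valid and ends in state `r` with `y` on top of the stack. -/
def runEndsAt {Q Γ : Type} [DecidableEq Q] [DecidableEq Γ] (q0 : Q) (bot : Γ)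
    (π : List (RTransition Q Γ)) (r : Q) (y : Γ) : Bool :=
  match execRun q0 bot π with
  | some (r', y' :: _) => decide (r = r' ∧ y = y')
  | _ => false

/-- Logistic sigmoid extended to `ℝ ∪ {-∞, +∞}`. -/
noncomputable def esigmoid (x : EReal) : ℝ :=
  if x = ⊥ then 0 else if x = ⊤ then 1 else 1 / (1 + Real.exp (-x.toReal))

/-- Hyperbolic tangent extended to `ℝ ∪ {-∞, +∞}`. -/
noncomputable def etanh (x : EReal) : ℝ :=
  if x = ⊥ then -1 else if x = ⊤ then 1 else Real.tanh x.toReal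

/-- Exponential function from `ℝ ∪ {-∞, +∞}` to `[0, ∞]`. -/
noncomputable def eexp (x : EReal) : ENNReal :=
  if x = ⊥ then 0 else if x = ⊤ then ⊤ else ENNReal.ofReal (Real.exp x.toReal)

/-- Affine map with weights and bias in `ℝ ∪ {-∞, +∞}` applied to a real vector. -/
noncomputable def eaffine {ι : Type} [Fintype ι] (W : ι → EReal) (b : EReal)
    (v : ι → ℝ) : EReal :=
  (∑ i, W i * ((v i : ℝ) : EReal)) + b

/-- A renormalizing nondeterministic stack RNN (RNS-RNN): an LSTM controller
(with parameters allowed to take values in `ℝ ∪ {-∞, +∞}`) coupled to a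
differentiable simulation of a real-time nondeterministic PDA with states `Q`,
stack alphabet `Γ`, start state `q0`, and bottom stack symbol `bot`. -/
structure RNSRNN (ι : Type) where
  Q : Type
  Γ : Type
  [finQ : Fintype Q]
  [decQ : DecidableEq Q]
  [finΓ : Fintype Γ]
  [decΓ : DecidableEq Γ]
  q0 : Q
  bot : Γ
  /-- input embedding dimension -/
  dIn : ℕ
  /-- hidden dimension -/
  d : ℕ
  /-- embedding of input symbols -/
  embed : ι → Fin dIn → ℝ
  /-- input gate weights (input = x_t ⊕ stack reading r_{t-1} ⊕ hidden h_{t-1}) -/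
  Wi : Fin d → (Fin dIn ⊕ (Q × Γ)) ⊕ Fin d → EReal
  bi : Fin d → EReal
  Wf : Fin d → (Fin dIn ⊕ (Q × Γ)) ⊕ Fin d → EReal
  bf : Fin d → EReal
  Wg : Fin d → (Fin dIn ⊕ (Q × Γ)) ⊕ Fin d → EReal
  bg : Fin d → EReal
  Wo : Fin d → (Fin dIn ⊕ (Q × Γ)) ⊕ Fin d → EReal
  bo : Fin d → EReal
  /-- affine map producing the PDA transition weights Δ[t] = exp(affine(h_t)) -/
  Wa : RTransition Q Γ → Fin d → EReal
  ba : RTransition Q Γ → EReal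

attribute [instance] RNSRNN.finQ RNSRNN.decQ RNSRNN.finΓ RNSRNN.decΓ

namespace RNSRNN

/-- Weight `ψ(π) = ∏ᵢ Δ[i][τᵢ]` of a run, given the history of transition weights. -/
noncomputable def runWeight {Q Γ : Type} (deltas : List (RTransition Q Γ → ENNReal))
    (π : List (RTransition Q Γ)) : ENNReal :=
  (List.zipWith (fun Δ τ => Δ τ) deltas π).prod

/-- Total weight of all runs of length `t = deltas.length` ending in state `r`
with `y` on top of the stack. -/
noncomputable def readingNum {Q Γ : Type} [Fintype Q] [Fintype Γ]
    [DecidableEq Q] [DecidableEq Γ] (q0 : Q) (bot : Γ)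
    (deltas : List (RTransition Q Γ → ENNReal)) (r : Q) (y : Γ) : ENNReal :=
  ∑ π : Fin deltas.length → RTransition Q Γ,
    if runEndsAt q0 bot (List.ofFn π) r y then runWeight deltas (List.ofFn π) else 0

/-- The stack reading: the renormalized marginal distribution over pairs
(current PDA state, top stack symbol). -/
noncomputable def reading {Q Γ : Type} [Fintype Q] [Fintype Γ]
    [DecidableEq Q] [DecidableEq Γ] (q0 : Q) (bot : Γ)
    (deltas : List (RTransition Q Γ → ENNReal)) : Q × Γ → ℝ :=
  fun p =>
    (readingNum q0 bot deltas p.1 p.2 /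
      ∑ p' : Q × Γ, readingNum q0 bot deltas p'.1 p'.2).toReal

variable {ι : Type}

/-- One timestep of the RNS-RNN: the LSTM controller reads the input symbol and the
previous stack reading, updates `(h, c)` by the standard LSTM equations, and emits
the new PDA transition weights `Δ[t] = exp(affine(h_t))`. The carried state is
`(h_t, c_t, [Δ[1], …, Δ[t]])`. -/
noncomputable def step (net : RNSRNN ι)
    (st : (Fin net.d → ℝ) × (Fin net.d → ℝ) × List (RTransition net.Q net.Γ → ENNReal))
    (a : ι) :
    (Fin net.d → ℝ) × (Fin net.d → ℝ) × List (RTransition net.Q net.Γ → ENNReal) :=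
  let rprev : net.Q × net.Γ → ℝ := reading net.q0 net.bot st.2.2
  let inp : (Fin net.dIn ⊕ (net.Q × net.Γ)) ⊕ Fin net.d → ℝ :=
    Sum.elim (Sum.elim (net.embed a) rprev) st.1
  let iGate : Fin net.d → ℝ := fun j => esigmoid (eaffine (net.Wi j) (net.bi j) inp)
  let fGate : Fin net.d → ℝ := fun j => esigmoid (eaffine (net.Wf j) (net.bf j) inp)
  let gGate : Fin net.d → ℝ := fun j => etanh (eaffine (net.Wg j) (net.bg j) inp)
  let oGate : Fin net.d → ℝ := fun j => esigmoid (eaffine (net.Wo j) (net.bo j) inp)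
  let c' : Fin net.d → ℝ := fun j => fGate j * st.2.1 j + iGate j * gGate j
  let h' : Fin net.d → ℝ := fun j => oGate j * Real.tanh (c' j)
  let Δ : RTransition net.Q net.Γ → ENNReal :=
    fun τ => eexp (eaffine (net.Wa τ) (net.ba τ) h')
  (h', c', st.2.2 ++ [Δ])

/-- Run the RNS-RNN on an input string, starting from `h₀ = c₀ = 0`. -/
noncomputable def run (net : RNSRNN ι) (w : List ι) :
    (Fin net.d → ℝ) × (Fin net.d → ℝ) × List (RTransition net.Q net.Γ → ENNReal) :=
  w.foldl net.step (0, 0, [])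

/-- Output of an MLP layer `y = σ(W₂ σ(W₁ h_{|w|} + b₁) + b₂)` applied to the final
hidden state after reading `w`. -/
noncomputable def output (net : RNSRNN ι) {m : ℕ} (W₁ : Fin m → Fin net.d → EReal)
    (b₁ : Fin m → EReal) (W₂ : Fin m → EReal) (b₂ : EReal) (w : List ι) : ℝ :=
  esigmoid (eaffine W₂ b₂ (fun j => esigmoid (eaffine (W₁ j) (b₁ j) (net.run w).1)))

/-- The RNS-RNN `net` (over the alphabet extended with an end-of-sequence symbol
`none = EOS`) recognizes the language `L`: there is an MLP layer such that, after
reading `w · EOS`, the output `y` satisfies `y > 1/2` iff `w ∈ L`. -/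
def Recognizes {σA : Type} (net : RNSRNN (Option σA)) (L : Language σA) : Prop :=
  ∃ (m : ℕ) (W₁ : Fin m → Fin net.d → EReal) (b₁ : Fin m → EReal)
    (W₂ : Fin m → EReal) (b₂ : EReal),
    ∀ w : List σA,
      1 / 2 < net.output W₁ b₁ W₂ b₂ (w.map some ++ [none]) ↔ w ∈ L

end RNSRNN

/-! ### Context-free languages as binary families of languages -/

/-- `u` concatenated with `v` lies in `ℓ X` for all nonempty `u ∈ ℓ Y` and `v ∈ ℓ Z`. -/
def IsBinaryRule {V T : Type} (ℓ : V → Language T) (X Y Z : V) : Prop :=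
  ∀ u v : List T, u ≠ [] → v ≠ [] → u ∈ ℓ Y → v ∈ ℓ Z → u ++ v ∈ ℓ X

/-- Every word of length at least two of the family `ℓ` splits along a binary rule, as in a
grammar in Chomsky normal form. -/
def IsBinaryFamily {V T : Type} (ℓ : V → Language T) : Prop :=
  ∀ (X : V) (w : List T), w ∈ ℓ X → 2 ≤ w.length →
    ∃ (Y Z : V) (u v : List T), IsBinaryRule ℓ X Y Z ∧ u ≠ [] ∧ v ≠ [] ∧
      u ∈ ℓ Y ∧ v ∈ ℓ Z ∧ w = u ++ v

namespace ContextFreeGrammar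

variable {T : Type} {g : ContextFreeGrammar T}

/-- Big-step semantics of a context-free grammar: the sentential form yields the word. -/
inductive Yields (g : ContextFreeGrammar T) : List (Symbol T g.NT) → List T → Prop
  | nil : Yields g [] []
  | terminal (a : T) {u : List (Symbol T g.NT)} {w : List T} (h : Yields g u w) :
      Yields g (Symbol.terminal a :: u) (a :: w)
  | nonterminal {r : ContextFreeRule T g.NT} (hr : r ∈ g.rules) {u : List (Symbol T g.NT)}
      {v w : List T} (hv : Yields g r.output v) (hw : Yields g u w) :
      Yields g (Symbol.nonterminal r.input :: u) (v ++ w)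

lemma Yields.append {u₁ u₂ : List (Symbol T g.NT)} {w₁ w₂ : List T} (h₁ : g.Yields u₁ w₁)
    (h₂ : g.Yields u₂ w₂) : g.Yields (u₁ ++ u₂) (w₁ ++ w₂) := by
  induction h₁ with
  | nil => exact h₂
  | terminal a _ ih => exact .terminal a ih
  | nonterminal hr hv _ _ ih =>
    rw [List.append_assoc]
    exact .nonterminal hr hv ih

lemma Yields.exists_of_append {u₁ u₂ : List (Symbol T g.NT)} {w : List T}
    (h : g.Yields (u₁ ++ u₂) w) :
    ∃ w₁ w₂, w = w₁ ++ w₂ ∧ g.Yields u₁ w₁ ∧ g.Yields u₂ w₂ := by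
  induction u₁ generalizing w with
  | nil => exact ⟨[], w, rfl, .nil, h⟩
  | cons s u ih =>
    rw [List.cons_append] at h
    cases h with
    | terminal a h =>
      obtain ⟨w₁, w₂, rfl, h₁, h₂⟩ := ih h
      exact ⟨a :: w₁, w₂, rfl, .terminal a h₁, h₂⟩
    | @nonterminal r hr _ v _ hv h =>
      obtain ⟨w₁, w₂, rfl, h₁, h₂⟩ := ih h
      exact ⟨v ++ w₁, w₂, (List.append_assoc ..).symm, .nonterminal hr hv h₁, h₂⟩

lemma yields_terminals (w : List T) : g.Yields (w.map Symbol.terminal) w := by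
  induction w with
  | nil => exact .nil
  | cons a w ih => exact .terminal a ih

lemma Yields.of_produces {u v : List (Symbol T g.NT)} {w : List T} (h : g.Produces u v)
    (hv : g.Yields v w) : g.Yields u w := by
  obtain ⟨r, hr, huv⟩ := h
  obtain ⟨p, q, rfl, rfl⟩ := huv.exists_parts
  obtain ⟨w', w₃, rfl, h', h₃⟩ := hv.exists_of_append
  obtain ⟨w₁, w₂, rfl, h₁, h₂⟩ := h'.exists_of_append
  refine (h₁.append ?_).append h₃
  simpa using Yields.nonterminal hr h₂ .nil

lemma Yields.derives {u : List (Symbol T g.NT)} {w : List T} (h : g.Yields u w) :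
    g.Derives u (w.map Symbol.terminal) := by
  induction h with
  | nil => rfl
  | terminal a _ ih => exact ih.append_left [Symbol.terminal a]
  | @nonterminal r hr u v w _ _ ih₁ ih₂ =>
    rw [List.map_append]
    refine Derives.trans (Produces.single ⟨r, hr, .head u⟩) ?_
    exact (ih₁.append_right u).trans (ih₂.append_left _)

lemma yields_iff_derives {u : List (Symbol T g.NT)} {w : List T} :
    g.Yields u w ↔ g.Derives u (w.map Symbol.terminal) := by
  refine ⟨Yields.derives, fun h ↦ ?_⟩
  induction h using Relation.ReflTransGen.head_induction_on with
  | refl => exact yields_terminals w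
  | head h _ ih => exact .of_produces h ih

/-- The sentential forms needed to split derivations: suffixes of the right-hand sides, the
initial symbol and the single terminals. -/
def splitForms (g : ContextFreeGrammar T) : Set (List (Symbol T g.NT)) :=
  {u | (∃ r ∈ g.rules, u <:+ r.output) ∨ u <:+ [Symbol.nonterminal g.initial] ∨
    ∃ a, u <:+ [Symbol.terminal a]}

lemma finite_splitForms [Finite T] : g.splitForms.Finite := by
  have hs (v : List (Symbol T g.NT)) : {u | u <:+ v}.Finite :=
    (List.finite_toSet v.tails).subset fun u hu ↦ by simpa using hu
  have h₁ : {u | ∃ r ∈ g.rules, u <:+ r.output}.Finite :=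
    (g.rules.finite_toSet.biUnion fun r _ ↦ hs r.output).subset fun u ⟨r, hr, hu⟩ ↦
      Set.mem_biUnion hr hu
  have h₂ : {u : List (Symbol T g.NT) | ∃ a, u <:+ [Symbol.terminal a]}.Finite :=
    (Set.finite_iUnion fun a : T ↦ hs [Symbol.terminal a]).subset fun u ⟨a, hu⟩ ↦
      Set.mem_iUnion.2 ⟨a, hu⟩
  exact h₁.union ((hs _).union h₂)

lemma mem_splitForms_of_suffix {u v : List (Symbol T g.NT)} (hv : v ∈ g.splitForms)
    (h : u <:+ v) : u ∈ g.splitForms := by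
  obtain ⟨r, hr, hv⟩ | hv | ⟨a, hv⟩ := hv
  exacts [.inl ⟨r, hr, h.trans hv⟩, .inr (.inl (h.trans hv)), .inr (.inr ⟨a, h.trans hv⟩)]

lemma Yields.exists_split {X : List (Symbol T g.NT)} {w : List T} (h : g.Yields X w)
    (hX : X ∈ g.splitForms) (hw : 2 ≤ w.length) :
    ∃ Y ∈ g.splitForms, ∃ Z ∈ g.splitForms, ∃ u v : List T,
      (∀ u v, u ≠ [] → v ≠ [] → g.Yields Y u → g.Yields Z v → g.Yields X (u ++ v)) ∧
      u ≠ [] ∧ v ≠ [] ∧ g.Yields Y u ∧ g.Yields Z v ∧ w = u ++ v := by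
  induction h with
  | nil => simp at hw
  | @terminal a X w h _ =>
    refine ⟨[Symbol.terminal a], .inr (.inr ⟨a, List.suffix_rfl⟩), X,
      mem_splitForms_of_suffix hX (List.suffix_cons ..), [a], w, ?_, by simp, ?_,
      .terminal a .nil, h, rfl⟩
    · exact fun u v _ _ hu hv ↦ hu.append hv
    · rintro rfl
      simp at hw
  | @nonterminal r hr X v₁ v₂ h₁ h₂ ih₁ ih₂ =>
    have hr' : r.output ∈ g.splitForms := .inl ⟨r, hr, List.suffix_rfl⟩
    have hX' : X ∈ g.splitForms := mem_splitForms_of_suffix hX (List.suffix_cons ..)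
    rcases eq_or_ne v₁ [] with rfl | hv₁
    · obtain ⟨Y, hY, Z, hZ, u, v, hYZ, h⟩ := ih₂ hX' hw
      exact ⟨Y, hY, Z, hZ, u, v, fun u v hu hv hu' hv' ↦
        by simpa using Yields.nonterminal hr h₁ (hYZ u v hu hv hu' hv'), h⟩
    rcases eq_or_ne v₂ [] with rfl | hv₂
    · rw [List.append_nil] at hw ⊢
      obtain ⟨Y, hY, Z, hZ, u, v, hYZ, h⟩ := ih₁ hr' hw
      refine ⟨Y, hY, Z, hZ, u, v, fun u v hu hv hu' hv' ↦ ?_, h⟩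
      simpa using Yields.nonterminal hr (hYZ u v hu hv hu' hv') h₂
    · exact ⟨r.output, hr', X, hX', v₁, v₂, fun u v _ _ hu hv ↦ .nonterminal hr hu hv,
        hv₁, hv₂, h₁, h₂, rfl⟩

end ContextFreeGrammar

lemma Language.IsContextFree.exists_isBinaryFamily {T : Type} [Finite T] {L : Language T}
    (hL : L.IsContextFree) :
    ∃ (V : Type) (_ : Finite V) (ℓ : V → Language T) (S : V), IsBinaryFamily ℓ ∧ ℓ S = L := by
  obtain ⟨g, rfl⟩ := hL
  refine ⟨g.splitForms, g.finite_splitForms, fun X ↦ {w | g.Yields X w},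
    ⟨[Symbol.nonterminal g.initial], .inr (.inl List.suffix_rfl)⟩, ?_, ?_⟩
  · intro X w hw hw'
    obtain ⟨Y, hY, Z, hZ, u, v, h⟩ := ContextFreeGrammar.Yields.exists_split hw X.2 hw'
    exact ⟨⟨Y, hY⟩, ⟨Z, hZ⟩, u, v, h⟩
  · ext w
    exact ContextFreeGrammar.yields_iff_derives

lemma IsBinaryFamily.sigma {I T : Type} {V : I → Type} {ℓ : ∀ i, V i → Language T}
    (h : ∀ i, IsBinaryFamily (ℓ i)) : IsBinaryFamily fun X : Σ i, V i ↦ ℓ X.1 X.2 := by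
  rintro ⟨i, X⟩ w hw hw'
  obtain ⟨Y, Z, h⟩ := h i X w hw hw'
  exact ⟨⟨i, Y⟩, ⟨i, Z⟩, h⟩

/-! ### Left-corner parsing -/

section LeftCorner

variable {V T K : Type} {k : ℕ} {ℓ : V → Language T} {S : Fin k → V}

/-- `LeftCorner ℓ A B v`: reading `v` completes a word of `ℓ A` whose already parsed left corner
is a word of `ℓ B`. -/
inductive LeftCorner (ℓ : V → Language T) : V → V → List T → Prop
  | refl (A : V) : LeftCorner ℓ A A []
  | step {A B C D E : V} {a : T} {v w : List T} (hC : IsBinaryRule ℓ C B D) (hE : [a] ∈ ℓ E)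
      (hv : LeftCorner ℓ D E v) (hw : LeftCorner ℓ A C w) : LeftCorner ℓ A B (a :: (v ++ w))

lemma LeftCorner.sound {A B : V} {v : List T} (h : LeftCorner ℓ A B v) :
    ∀ u : List T, u ≠ [] → u ∈ ℓ B → u ++ v ∈ ℓ A := by
  induction h with
  | refl => simp
  | @step A B C D E a v w hC hE _ _ ih₁ ih₂ =>
    intro u hu huB
    have h := ih₂ (u ++ a :: v) (by simp) (hC _ _ hu (by simp) huB (ih₁ [a] (by simp) hE))
    simpa using h

lemma LeftCorner.extend {A Y Z E F : V} {b : T} {u v : List T} (hu : LeftCorner ℓ Y E u)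
    (hA : IsBinaryRule ℓ A Y Z) (hF : [b] ∈ ℓ F) (hv : LeftCorner ℓ Z F v) :
    LeftCorner ℓ A E (u ++ b :: v) := by
  induction hu with
  | refl => simpa using LeftCorner.step hA hF hv (.refl A)
  | step hC hE h _ _ ih => simpa using LeftCorner.step hC hE h (ih hA)

lemma IsBinaryFamily.exists_leftCorner (hℓ : IsBinaryFamily ℓ) {A : V} {w : List T}
    (hw : w ∈ ℓ A) (hw' : w ≠ []) :
    ∃ (a : T) (v : List T) (E : V), w = a :: v ∧ [a] ∈ ℓ E ∧ LeftCorner ℓ A E v := by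
  induction hn : w.length using Nat.strong_induction_on generalizing A w with
  | _ n ih =>
    subst hn
    match w, hw' with
    | [a], _ => exact ⟨a, [], A, rfl, hw, .refl A⟩
    | a :: b :: w, _ =>
      obtain ⟨Y, Z, u, v, hA, hu, hv, huY, hvZ, huv⟩ := hℓ A _ hw (by simp)
      have hlen := congrArg List.length huv
      have hu' := List.length_pos_iff.2 hu
      have hv' := List.length_pos_iff.2 hv
      rw [List.length_append] at hlen
      obtain ⟨c, u, E, rfl, hE, hYE⟩ := ih u.length (by omega) huY hu rfl
      obtain ⟨d, v, F, rfl, hF, hZF⟩ := ih v.length (by omega) hvZ hv rfl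
      exact ⟨c, u ++ d :: v, E, huv, hE, hYE.extend hA hF hZF⟩

/-- Concatenation of words completing each pair of a list. -/
inductive LeftCorners (ℓ : V → Language T) : List (V × V) → List T → Prop
  | nil : LeftCorners ℓ [] []
  | cons {A B : V} {v w : List T} {l : List (V × V)} (hv : LeftCorner ℓ A B v)
      (hw : LeftCorners ℓ l w) : LeftCorners ℓ ((A, B) :: l) (v ++ w)

/-! ### Real-time prefix rewriting -/

/-- Real-time runs that rewrite the first symbol of a configuration according to `R`, always
keeping the rest of the configuration nonempty beforehand. -/
inductive PrefixRun (R : K → T → List K → Prop) : List K → List T → List K → Prop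
  | nil (c : List K) : PrefixRun R c [] c
  | cons {n x : K} {a : T} {γ s c : List K} {w : List T} (hn : R n a γ)
      (h : PrefixRun R (γ ++ x :: s) w c) : PrefixRun R (n :: x :: s) (a :: w) c

lemma PrefixRun.cons' {R : K → T → List K → Prop} {n : K} {a : T} {γ c c' : List K}
    {w : List T} (hn : R n a γ) (hc : c ≠ []) (h : PrefixRun R (γ ++ c) w c') :
    PrefixRun R (n :: c) (a :: w) c' := by
  cases c with
  | nil => exact absurd rfl hc
  | cons x s => exact .cons hn h

/-- Symbols of the left-corner machine: the initial (and bottom) symbol `none`, pairs of a goal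
and its left corner, and end markers of the `k` parsers. -/
abbrev LCSymbol (V : Type) (k : ℕ) : Type := Option ((V × V) ⊕ Fin k)

/-- The symbol standing for a goal and its left corner. -/
abbrev LCSymbol.pair (p : V × V) : LCSymbol V k := some (.inl p)

/-- The end marker of a parser. -/
abbrev LCSymbol.marker (i : Fin k) : LCSymbol V k := some (.inr i)

/-- The configurations in which a goal may be put; a completed goal may be dropped. -/
inductive Pending : V → V → List (LCSymbol V k) → Prop
  | keep (A B : V) : Pending A B [LCSymbol.pair (A, B)]
  | drop (A : V) : Pending A A []

/-- Rewriting rules of the left-corner machine running one of `k` parsers. -/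
inductive LCRule (ℓ : V → Language T) (S : Fin k → V) :
    LCSymbol V k → T → List (LCSymbol V k) → Prop
  | start {i : Fin k} {E : V} {a : T} {γ : List (LCSymbol V k)} (hE : [a] ∈ ℓ E)
      (hγ : Pending (S i) E γ) : LCRule ℓ S none a (γ ++ [LCSymbol.marker i])
  | step {A B C D E : V} {a : T} {γ₁ γ₂ : List (LCSymbol V k)} (hC : IsBinaryRule ℓ C B D)
      (hE : [a] ∈ ℓ E) (h₁ : Pending D E γ₁) (h₂ : Pending A C γ₂) :
      LCRule ℓ S (LCSymbol.pair (A, B)) a (γ₁ ++ γ₂)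

lemma Pending.length_le {A B : V} {γ : List (LCSymbol V k)} (h : Pending A B γ) :
    γ.length ≤ 1 := by
  cases h <;> simp

lemma LCRule.length_le {n : LCSymbol V k} {a : T} {γ : List (LCSymbol V k)}
    (h : LCRule ℓ S n a γ) : γ.length ≤ 2 := by
  cases h with
  | start _ hγ =>
    have := hγ.length_le
    simp
    omega
  | step _ _ h₁ h₂ =>
    have := h₁.length_le
    have := h₂.length_le
    simp
    omega

lemma Pending.exists_eq_map {A B : V} {γ : List (LCSymbol V k)} (h : Pending A B γ) :
    ∃ l : List (V × V), γ = l.map LCSymbol.pair ∧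
      ∀ l' w, LeftCorners ℓ (l ++ l') w →
        ∃ u v, w = u ++ v ∧ LeftCorner ℓ A B u ∧ LeftCorners ℓ l' v := by
  cases h with
  | keep =>
    refine ⟨[(A, B)], rfl, fun l' w hw ↦ ?_⟩
    cases hw with
    | cons hv hw => exact ⟨_, _, rfl, hv, hw⟩
  | drop => exact ⟨[], rfl, fun l' w hw ↦ ⟨[], w, rfl, .refl _, hw⟩⟩

lemma PrefixRun.leftCorners {j : Fin k} {c c' : List (LCSymbol V k)} {v : List T}
    (h : PrefixRun (LCRule ℓ S) c v c') :
    ∀ l : List (V × V), c = l.map LCSymbol.pair ++ [LCSymbol.marker j, none] →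
      ∃ l' : List (V × V), c' = l'.map LCSymbol.pair ++ [LCSymbol.marker j, none] ∧
        ∀ v', LeftCorners ℓ l' v' → LeftCorners ℓ l (v ++ v') := by
  induction h with
  | nil c => exact fun l hl ↦ ⟨l, hl, fun v' h ↦ h⟩
  | @cons n x a γ s c w hn _ ih =>
    rintro (_ | ⟨⟨A, B⟩, l⟩) hl
    · obtain ⟨rfl, -⟩ := List.cons_eq_cons.1 hl
      cases hn
    · rw [List.map_cons, List.cons_append] at hl
      obtain ⟨rfl, hs⟩ := List.cons_eq_cons.1 hl
      cases hn with
      | step hC hE h₁ h₂ =>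
        obtain ⟨l₁, rfl, hl₁⟩ := h₁.exists_eq_map (ℓ := ℓ)
        obtain ⟨l₂, rfl, hl₂⟩ := h₂.exists_eq_map (ℓ := ℓ)
        obtain ⟨l', rfl, hl'⟩ := ih (l₁ ++ (l₂ ++ l)) (by simp [hs])
        refine ⟨l', rfl, fun v' hv' ↦ ?_⟩
        obtain ⟨u₁, w', hw, hu₁, hw'⟩ := hl₁ _ _ (hl' v' hv')
        obtain ⟨u₂, w'', rfl, hu₂, hw''⟩ := hl₂ _ _ hw'
        have := LeftCorners.cons (LeftCorner.step hC hE hu₁ hu₂) hw''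
        simpa [hw] using this

lemma LeftCorner.exists_pending {A B : V} {v : List T} (h : LeftCorner ℓ A B v) :
    ∃ γ : List (LCSymbol V k), Pending A B γ ∧ ∀ c c' w, c ≠ [] →
      PrefixRun (LCRule ℓ S) c w c' → PrefixRun (LCRule ℓ S) (γ ++ c) (v ++ w) c' := by
  induction h with
  | refl A => exact ⟨[], .drop A, fun c c' w _ h ↦ h⟩
  | @step A B C D E a v w hC hE _ _ ih₁ ih₂ =>
    obtain ⟨γ₁, hγ₁, h₁⟩ := ih₁
    obtain ⟨γ₂, hγ₂, h₂⟩ := ih₂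
    refine ⟨[LCSymbol.pair (A, B)], .keep A B, fun c c' w' hc h ↦ ?_⟩
    refine PrefixRun.cons' (.step hC hE hγ₁ hγ₂) hc ?_
    simpa using h₁ _ _ _ (by simp [hc]) (h₂ _ _ _ hc h)

theorem IsBinaryFamily.mem_iff_prefixRun (hℓ : IsBinaryFamily ℓ) (S : Fin k → V) (i : Fin k)
    (w : List T) :
    w ∈ ℓ (S i) ↔
      (∃ s, PrefixRun (LCRule ℓ S) [none, none] w (LCSymbol.marker i :: none :: s)) ∨
      ([] ∈ ℓ (S i) ∧ ∃ s, PrefixRun (LCRule ℓ S) [none, none] w (none :: none :: s)) := by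
  constructor
  · intro hw
    rcases eq_or_ne w [] with rfl | hw'
    · exact .inr ⟨hw, [], .nil _⟩
    · obtain ⟨a, v, E, rfl, hE, h⟩ := hℓ.exists_leftCorner hw hw'
      obtain ⟨γ, hγ, h⟩ := h.exists_pending (S := S)
      refine .inl ⟨[], .cons (.start hE hγ) ?_⟩
      have := h [LCSymbol.marker i, none] _ [] (by simp) (.nil _)
      simpa using this
  · have key : ∀ {a : T} {v : List T} {c : List (LCSymbol V k)},
        PrefixRun (LCRule ℓ S) [none, none] (a :: v) c →
        ∃ (j : Fin k) (l : List (V × V)), c = l.map LCSymbol.pair ++ [LCSymbol.marker j, none] ∧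
          (l = [] → a :: v ∈ ℓ (S j)) := by
      intro a v c h
      cases h with
      | cons hn h =>
        cases hn with
        | @start j E _ γ hE hγ =>
          obtain ⟨l, rfl, hl⟩ := hγ.exists_eq_map (ℓ := ℓ)
          obtain ⟨l', rfl, hl'⟩ := h.leftCorners (j := j) l (by simp)
          refine ⟨j, l', rfl, ?_⟩
          rintro rfl
          obtain ⟨u₁, u₂, hv, hu₁, hu₂⟩ := hl [] v (by simpa using hl' [] .nil)
          cases hu₂
          rw [List.append_nil] at hv
          exact hv ▸ hu₁.sound [a] (by simp) hE
    rintro (⟨s, h⟩ | ⟨h₀, s, h⟩)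
    · match w, h with
      | [], h => cases h
      | a :: v, h =>
        obtain ⟨j, _ | ⟨p, l⟩, hc, hl⟩ := key h
        · obtain ⟨rfl⟩ : i = j := by simpa using (List.cons_eq_cons.1 hc).1
          exact hl rfl
        · simp at hc
    · match w, h with
      | [], h => exact h₀
      | a :: v, h =>
        obtain ⟨j, _ | ⟨p, l⟩, hc, hl⟩ := key h <;> simp at hc

end LeftCorner

/-! ### Simulation by restricted pushdown automata -/

section Pushdown

variable {K T : Type} {R : K → T → List K → Prop}

/-- The restricted transitions on the input symbol `a` of the automaton whose state is the first
symbol of a configuration of the prefix rewriting system `R`. -/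
def RTransition.IsAllowed (R : K → T → List K → Prop) (a : T) : RTransition K K → Prop
  | .push q _ r y => R q a [r, y]
  | .replace q x r y => y = x ∧ R q a [r]
  | .pop q x r => r = x ∧ R q a []

lemma execRun_eq_some_iff [DecidableEq K] (hR : ∀ n a γ, R n a γ → γ.length ≤ 2) (w : List T)
    (q x : K) (s : List K) (q' : K) (s' : List K) :
    (∃ π : List (RTransition K K), List.Forall₂ (RTransition.IsAllowed R) w π ∧
      π.foldl (fun c τ ↦ c.bind τ.apply) (some (q, x :: s)) = some (q', s') ∧ s' ≠ []) ↔
    PrefixRun R (q :: x :: s) w (q' :: s') ∧ s' ≠ [] := by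
  have hnone : ∀ π : List (RTransition K K),
      π.foldl (fun c τ ↦ c.bind τ.apply) (none : Option (K × List K)) = none := by
    intro π
    induction π with
    | nil => rfl
    | cons τ π ih => simpa using ih
  have hnil : ∀ (π : List (RTransition K K)) (q : K),
      π.foldl (fun c τ ↦ c.bind τ.apply) (some (q, [])) = some (q', s') → s' = [] := by
    intro π q h
    cases π with
    | nil => simpa using (congrArg (Option.map Prod.snd) h).symm
    | cons τ π => cases τ <;> simp [RTransition.apply, hnone] at h
  have hrun : ∀ (w : List T) (q : K), PrefixRun R [q] w (q' :: s') → s' = [] := by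
    intro w q h
    cases h
    rfl
  induction w generalizing q x s with
  | nil =>
    constructor
    · rintro ⟨π, hπ, h, hs'⟩
      cases hπ
      obtain ⟨rfl, rfl⟩ : q = q' ∧ x :: s = s' := by simpa using h
      exact ⟨.nil _, hs'⟩
    · rintro ⟨h, hs'⟩
      cases h
      exact ⟨[], .nil, rfl, hs'⟩
  | cons a w ih =>
    constructor
    · rintro ⟨_, hπ, h, hs'⟩
      refine ⟨?_, hs'⟩
      cases hπ with
      | @cons _ τ _ π hτ hπ =>
      cases τ with
      | push p y r z =>
        by_cases hp : p = q ∧ y = x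
        · obtain ⟨rfl, rfl⟩ := hp
          exact .cons hτ ((ih _ _ _).1 ⟨π, hπ, by simpa [RTransition.apply] using h, hs'⟩).1
        · simp [RTransition.apply, hp, hnone] at h
      | replace p y r z =>
        by_cases hp : p = q ∧ y = x
        · obtain ⟨rfl, rfl⟩ := hp
          obtain ⟨rfl, hτ⟩ := hτ
          exact .cons hτ ((ih _ _ _).1 ⟨π, hπ, by simpa [RTransition.apply] using h, hs'⟩).1
        · simp [RTransition.apply, hp, hnone] at h
      | pop p y r =>
        by_cases hp : p = q ∧ y = x
        · obtain ⟨rfl, rfl⟩ := hp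
          obtain ⟨rfl, hτ⟩ := hτ
          have h : π.foldl (fun c τ ↦ c.bind τ.apply) (some (r, s)) = some (q', s') := by
            simpa [RTransition.apply] using h
          cases s with
          | nil => exact absurd (hnil π r h) hs'
          | cons y s => exact .cons hτ ((ih _ _ _).1 ⟨π, hπ, h, hs'⟩).1
        · simp [RTransition.apply, hp, hnone] at h
    · rintro ⟨h, hs'⟩
      cases h with
      | @cons _ _ _ γ _ _ _ hn h =>
      match γ, hR _ _ _ hn with
      | [], _ =>
        cases s with
        | nil => exact absurd (hrun w x h) hs'
        | cons y s =>
          obtain ⟨π, hπ, h, -⟩ := (ih _ _ _).2 ⟨h, hs'⟩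
          exact ⟨.pop q x x :: π, .cons ⟨rfl, hn⟩ hπ, by simpa [RTransition.apply] using h, hs'⟩
      | [r], _ =>
        obtain ⟨π, hπ, h, -⟩ := (ih _ _ _).2 ⟨h, hs'⟩
        exact ⟨.replace q x r x :: π, .cons ⟨rfl, hn⟩ hπ,
          by simpa [RTransition.apply] using h, hs'⟩
      | [r, y], _ =>
        obtain ⟨π, hπ, h, -⟩ := (ih _ _ _).2 ⟨h, hs'⟩
        exact ⟨.push q x r y :: π, .cons hn hπ, by simpa [RTransition.apply] using h, hs'⟩
      | _ :: _ :: _ :: _, hγ => simp at hγ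

lemma runEndsAt_iff [DecidableEq K] {q₀ b r y : K} {π : List (RTransition K K)} :
    runEndsAt q₀ b π r y ↔ ∃ s, execRun q₀ b π = some (r, y :: s) := by
  unfold runEndsAt
  split
  · rename_i r' y' s h
    rw [h]
    constructor
    · intro h'
      obtain ⟨rfl, rfl⟩ := of_decide_eq_true h'
      exact ⟨s, rfl⟩
    · rintro ⟨s', h'⟩
      simp_all
  · rename_i h
    simp only [Bool.false_eq_true, false_iff]
    rintro ⟨s, h'⟩
    exact h _ _ _ h'

lemma exists_runEndsAt_iff [DecidableEq K] (hR : ∀ n a γ, R n a γ → γ.length ≤ 2)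
    (w : List T) (q₀ b r y : K) :
    (∃ π : List (RTransition K K),
      List.Forall₂ (RTransition.IsAllowed R) w π ∧ runEndsAt q₀ b π r y) ↔
    ∃ s, PrefixRun R [q₀, b] w (r :: y :: s) := by
  simp_rw [runEndsAt_iff]
  have h s := execRun_eq_some_iff hR w q₀ b [] r (y :: s)
  simp only [ne_eq, reduceCtorEq, not_false_eq_true, and_true] at h
  simp_rw [← h, execRun]
  exact ⟨fun ⟨π, hπ, s, h⟩ ↦ ⟨s, π, hπ, h⟩, fun ⟨s, π, hπ, h⟩ ↦ ⟨π, hπ, s, h⟩⟩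

end Pushdown

/-! ### The stack reading for transition weights in `{0, 1}` -/

namespace RNSRNN

section Reading

variable {Q Γ T : Type} {P : T → RTransition Q Γ → Prop}

/-- Transition weights that are `1` on the allowed transitions and `0` elsewhere. -/
noncomputable def indicatorWeight (P : T → RTransition Q Γ → Prop) (a : T)
    (τ : RTransition Q Γ) : ENNReal :=
  if P a τ then 1 else 0

lemma runWeight_indicatorWeight (w : List T) (π : List (RTransition Q Γ))
    (h : π.length = w.length) :
    runWeight (w.map (indicatorWeight P)) π = if List.Forall₂ P w π then 1 else 0 := by
  induction w generalizing π with
  | nil =>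
    obtain rfl := List.length_eq_zero_iff.1 h
    simp [runWeight]
  | cons a w ih =>
    obtain _ | ⟨τ, π⟩ := π
    · simp at h
    have ih := ih π (by simpa using h)
    simp only [runWeight] at ih
    simp only [runWeight, List.map_cons, List.zipWith_cons_cons, List.prod_cons, ih,
      List.forall₂_cons, indicatorWeight]
    by_cases h₁ : P a τ <;> by_cases h₂ : List.Forall₂ P w π <;> simp [h₁, h₂]

variable [Fintype Q] [Fintype Γ] [DecidableEq Q] [DecidableEq Γ]

lemma readingNum_indicatorWeight_ne_top (q₀ : Q) (b : Γ) (w : List T) (r : Q) (y : Γ) :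
    readingNum q₀ b (w.map (indicatorWeight P)) r y ≠ ⊤ := by
  refine ENNReal.sum_ne_top.2 fun π _ ↦ ?_
  rw [runWeight_indicatorWeight _ _ (by simp)]
  split_ifs <;> simp

lemma readingNum_indicatorWeight_ne_zero (q₀ : Q) (b : Γ) (w : List T) (r : Q) (y : Γ) :
    readingNum q₀ b (w.map (indicatorWeight P)) r y ≠ 0 ↔
      ∃ π, List.Forall₂ P w π ∧ runEndsAt q₀ b π r y := by
  rw [readingNum, ne_eq, Finset.sum_eq_zero_iff]
  push Not
  constructor
  · rintro ⟨π, -, hπ⟩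
    rw [runWeight_indicatorWeight _ _ (by simp)] at hπ
    refine ⟨List.ofFn π, ?_⟩
    by_contra h
    apply hπ
    split_ifs <;> tauto
  · rintro ⟨π, hπ, h⟩
    have hlen : π.length = (w.map (indicatorWeight P)).length := by
      rw [List.length_map, hπ.length_eq]
    have hof : List.ofFn (fun i : Fin (w.map (indicatorWeight P)).length ↦
        π.get (i.cast hlen.symm)) = π := by
      rw [← List.ofFn_congr hlen π.get, List.ofFn_get]
    refine ⟨fun i ↦ π.get (i.cast hlen.symm), Finset.mem_univ _, ?_⟩
    rw [hof, if_pos h, runWeight_indicatorWeight _ _ hπ.length_eq.symm, if_pos hπ]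
    exact one_ne_zero

lemma reading_nonneg (q₀ : Q) (b : Γ) (δ : List (RTransition Q Γ → ENNReal)) (p : Q × Γ) :
    0 ≤ reading q₀ b δ p :=
  ENNReal.toReal_nonneg

lemma reading_indicatorWeight_pos (q₀ : Q) (b : Γ) (w : List T) (p : Q × Γ) :
    0 < reading q₀ b (w.map (indicatorWeight P)) p ↔
      ∃ π, List.Forall₂ P w π ∧ runEndsAt q₀ b π p.1 p.2 := by
  rw [← readingNum_indicatorWeight_ne_zero, reading, ENNReal.toReal_pos_iff, pos_iff_ne_zero,
    ENNReal.div_ne_zero]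
  constructor
  · exact fun h ↦ h.1.1
  · intro h
    refine ⟨⟨h, ENNReal.sum_ne_top.2 fun p _ ↦ readingNum_indicatorWeight_ne_top _ _ _ _ _⟩,
      ENNReal.div_lt_top (readingNum_indicatorWeight_ne_top _ _ _ _ _) ?_⟩
    rw [ne_eq, Finset.sum_eq_zero_iff]
    exact fun h' ↦ h (h' p (Finset.mem_univ _))

end Reading

end RNSRNN

/-! ### The network -/

lemma eaffine_coe {ι : Type} [Fintype ι] (c : ι → ℝ) (b : ℝ) (v : ι → ℝ) :
    eaffine (fun i ↦ (c i : EReal)) b v = ((∑ i, c i * v i + b : ℝ) : EReal) := by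
  have h (s : Finset ι) :
      ∑ i ∈ s, (c i : EReal) * (v i : EReal) = ((∑ i ∈ s, c i * v i : ℝ) : EReal) := by
    induction s using Finset.induction_on with
    | empty => simp
    | insert i s hi ih =>
      rw [Finset.sum_insert hi, Finset.sum_insert hi, ih, EReal.coe_add, EReal.coe_mul]
  rw [eaffine, h, EReal.coe_add]

lemma eaffine_zero_left {ι : Type} [Fintype ι] (b : EReal) (v : ι → ℝ) :
    eaffine 0 b v = b := by
  simp [eaffine]

lemma esigmoid_coe (x : ℝ) : esigmoid x = 1 / (1 + Real.exp (-x)) := by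
  simp [esigmoid]

lemma half_lt_esigmoid_coe_iff (x : ℝ) : 1 / 2 < esigmoid x ↔ 0 < x := by
  rw [esigmoid_coe, one_div_lt_one_div (by norm_num) (by positivity)]
  constructor
  · intro h
    have : Real.exp (-x) < 1 := by linarith
    simpa using this
  · intro h
    have : Real.exp (-x) < 1 := by simpa using h
    linarith

lemma tanh_tanh_pos_iff (x : ℝ) : 0 < Real.tanh (Real.tanh x) ↔ 0 < x := by
  have h (y : ℝ) : 0 < Real.tanh y ↔ 0 < y := by
    rw [Real.tanh_eq_sinh_div_cosh, div_pos_iff_of_pos_right (Real.cosh_pos y),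
      Real.sinh_pos_iff]
  rw [h, h]

namespace RNSRNN

section Detector

variable {T : Type} {k : ℕ}

/-- The weights of the inputs of each hidden unit: the units `Sum.inl a` detect the input symbol
`a` and the units `Sum.inr i` measure the stack reading of the set `F i`. -/
noncomputable def unitWeights {D N H : Type} (u : T → D) (F : Fin k → N → Prop) :
    T ⊕ Fin k → (D ⊕ N) ⊕ H → ℝ :=
  Sum.elim (fun a ↦ Sum.elim (Sum.elim (fun m ↦ if m = u a then 1 else 0) 0) 0)
    (fun i ↦ Sum.elim (Sum.elim 0 fun p ↦ if F i p then 1 else 0) 0)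

/-- The network allows exactly the transitions `P a` on the input symbol `a`, and its hidden
units report whether the previous stack reading meets the sets `F i`. -/
structure IsDetector (net : RNSRNN (Option T)) (P : T → RTransition net.Q net.Γ → Prop)
    (F : Fin k → net.Q × net.Γ → Prop) (u : T → Fin net.dIn)
    (e : T ⊕ Fin k ≃ Fin net.d) : Prop where
  embed_apply : ∀ x a, net.embed x (u a) = if x = some a then 1 else 0
  Wi_eq : ∀ j, net.Wi j = 0
  bi_eq : ∀ j, net.bi j = ⊤
  Wf_eq : ∀ j, net.Wf j = 0
  bf_eq : ∀ j, net.bf j = ⊥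
  Wg_eq : ∀ j, net.Wg (e j) = fun y ↦ (unitWeights u F j y : EReal)
  bg_eq : ∀ j, net.bg j = ((0 : ℝ) : EReal)
  Wo_eq : ∀ j, net.Wo j = 0
  bo_eq : ∀ j, net.bo j = ⊤
  Wa_inl : ∀ τ a, net.Wa τ (e (.inl a)) = if P a τ then 0 else ⊥
  Wa_inr : ∀ τ i, net.Wa τ (e (.inr i)) = 0
  ba_eq : ∀ τ, net.ba τ = 0

namespace IsDetector

variable {net : RNSRNN (Option T)} {P : T → RTransition net.Q net.Γ → Prop}
  {F : Fin k → net.Q × net.Γ → Prop} {u : T → Fin net.dIn} {e : T ⊕ Fin k ≃ Fin net.d}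

lemma step_hidden (hnet : net.IsDetector P F u e) (st) (x : Option T) (j : T ⊕ Fin k) :
    (net.step st x).1 (e j) = Real.tanh (Real.tanh (∑ y, unitWeights u F j y *
      Sum.elim (Sum.elim (net.embed x) (reading net.q0 net.bot st.2.2)) st.1 y)) := by
  simp only [step, hnet.Wi_eq, hnet.bi_eq, hnet.Wf_eq, hnet.bf_eq, hnet.Wg_eq, hnet.bg_eq,
    hnet.Wo_eq, hnet.bo_eq, eaffine_zero_left, eaffine_coe, add_zero]
  simp only [esigmoid, etanh, EReal.coe_ne_bot, EReal.coe_ne_top, EReal.toReal_coe, if_false,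
    if_true, top_ne_bot, zero_mul, one_mul, zero_add]

lemma step_hidden_inl (hnet : net.IsDetector P F u e) (st) (x : Option T) (a : T) :
    (net.step st x).1 (e (.inl a)) = if x = some a then Real.tanh (Real.tanh 1) else 0 := by
  rw [hnet.step_hidden, Fintype.sum_sum_type, Fintype.sum_sum_type]
  simp only [unitWeights, Sum.elim_inl, Sum.elim_inr, Pi.zero_apply, zero_mul,
    Finset.sum_const_zero, add_zero]
  rw [Fintype.sum_eq_single (u a) fun m hm ↦ by simp [hm], if_pos rfl,
    hnet.embed_apply]
  split_ifs <;> simp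

lemma step_hidden_inr (hnet : net.IsDetector P F u e) (st) (x : Option T) (i : Fin k) :
    (net.step st x).1 (e (.inr i)) = Real.tanh (Real.tanh (∑ p,
      (if F i p then 1 else 0) * reading net.q0 net.bot st.2.2 p)) := by
  rw [hnet.step_hidden, Fintype.sum_sum_type, Fintype.sum_sum_type]
  simp only [unitWeights, Sum.elim_inl, Sum.elim_inr, Pi.zero_apply, zero_mul,
    Finset.sum_const_zero, add_zero, zero_add]

lemma step_weights [Fintype T] (hnet : net.IsDetector P F u e) (st) (a : T) :
    (net.step st (some a)).2.2 = st.2.2 ++ [indicatorWeight P a] := by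
  set h := (net.step st (some a)).1 with hh
  have hΔ : (net.step st (some a)).2.2 =
    st.2.2 ++ [fun τ ↦ eexp (eaffine (net.Wa τ) (net.ba τ) h)] := rfl
  rw [hΔ]
  congr 2
  funext τ
  have ha : eaffine (net.Wa τ) (net.ba τ) h = if P a τ then 0 else ⊥ := by
    rw [eaffine, ← e.sum_comp, hnet.ba_eq, add_zero, Fintype.sum_eq_single (.inl a)]
    · have : 0 < Real.tanh (Real.tanh 1) := (tanh_tanh_pos_iff 1).2 one_pos
      rw [hnet.Wa_inl, hh, hnet.step_hidden_inl, if_pos rfl]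
      split_ifs
      · simp
      · exact EReal.bot_mul_coe_of_pos this
    · rintro (a' | i) hj
      · have : a ≠ a' := fun h ↦ hj (h ▸ rfl)
        rw [hh, hnet.step_hidden_inl]
        simp [this]
      · rw [hnet.Wa_inr, zero_mul]
  simp only [ha, indicatorWeight, eexp]
  split_ifs <;> simp_all

lemma run_weights [Fintype T] (hnet : net.IsDetector P F u e) (w : List T) :
    (net.run (w.map some)).2.2 = w.map (indicatorWeight P) := by
  induction w using List.reverseRecOn with
  | nil => rfl
  | append_singleton w a ih =>
    rw [run] at ih ⊢
    rw [List.map_append, List.foldl_append, List.map_append, List.map_singleton, List.foldl_cons,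
      List.foldl_nil, hnet.step_weights, ih, List.map_singleton]

lemma run_hidden_inr [Fintype T] (hnet : net.IsDetector P F u e) (w : List T) (i : Fin k) :
    ∃ h : ℝ, 0 ≤ h ∧ (net.run (w.map some ++ [none])).1 (e (.inr i)) = h ∧
      (0 < h ↔ ∃ p, F i p ∧ ∃ π, List.Forall₂ P w π ∧ runEndsAt net.q0 net.bot π p.1 p.2) := by
  have hnonneg (p : net.Q × net.Γ) : 0 ≤ (if F i p then 1 else 0) *
      reading net.q0 net.bot (w.map (indicatorWeight P)) p :=
    mul_nonneg (by split_ifs <;> simp) (reading_nonneg ..)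
  refine ⟨_, ?_, rfl, ?_⟩
  all_goals
    rw [run, List.foldl_append, List.foldl_cons, List.foldl_nil, hnet.step_hidden_inr,
      ← run, hnet.run_weights]
  · rw [← not_lt, ← neg_pos, ← Real.tanh_neg, ← Real.tanh_neg, tanh_tanh_pos_iff, neg_pos, not_lt]
    exact Finset.sum_nonneg fun p _ ↦ hnonneg p
  · rw [tanh_tanh_pos_iff, Finset.sum_pos_iff_of_nonneg fun p _ ↦ hnonneg p]
    simp only [Finset.mem_univ, true_and]
    refine exists_congr fun p ↦ ?_
    by_cases hp : F i p
    · simp [hp, reading_indicatorWeight_pos]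
    · simp [hp]

theorem recognizes [Fintype T] (hnet : net.IsDetector P F u e) :
    net.Recognizes {w | ∀ i, ∃ p, F i p ∧
      ∃ π, List.Forall₂ P w π ∧ runEndsAt net.q0 net.bot π p.1 p.2} := by
  refine ⟨k, fun i j ↦ if j = e (.inr i) then ⊤ else 0, 0, fun _ ↦ ((1 : ℝ) : EReal),
    ((1 / 4 - k : ℝ) : EReal), fun w ↦ ?_⟩
  choose h h₀ hh hiff using hnet.run_hidden_inr w
  have hy (i : Fin k) : esigmoid (eaffine (fun j ↦ if j = e (.inr i) then ⊤ else 0)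
      ((0 : Fin k → EReal) i) (net.run (w.map some ++ [none])).1) =
      if 0 < h i then 1 else 1 / 2 := by
    rw [eaffine, Fintype.sum_eq_single (e (.inr i)) fun j hj ↦ by simp [hj], if_pos rfl, hh,
      Pi.zero_apply, add_zero]
    split_ifs with hi
    · rw [EReal.top_mul_coe_of_pos hi]
      simp [esigmoid]
    · rw [le_antisymm (not_lt.1 hi) (h₀ i), EReal.coe_zero, mul_zero, ← EReal.coe_zero,
        esigmoid_coe]
      norm_num
  rw [output, funext hy, eaffine_coe, half_lt_esigmoid_coe_iff]
  simp only [one_mul]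
  change _ ↔ ∀ i, ∃ p, F i p ∧ ∃ π, List.Forall₂ P w π ∧ runEndsAt net.q0 net.bot π p.1 p.2
  simp_rw [← hiff]
  constructor
  · intro hpos
    by_contra! ⟨i, hi⟩
    have hle : ∑ i, (if 0 < h i then (1 : ℝ) else 1 / 2) ≤ k - 1 / 2 := by
      rw [← Finset.add_sum_erase _ _ (Finset.mem_univ i), if_neg hi.not_gt]
      have := Finset.sum_le_card_nsmul (Finset.univ.erase i)
        (fun i ↦ if 0 < h i then (1 : ℝ) else 1 / 2) 1 fun j _ ↦ by split_ifs <;> norm_num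
      rw [Finset.card_erase_of_mem (Finset.mem_univ i), Finset.card_univ, Fintype.card_fin,
        nsmul_one, Nat.cast_pred i.pos] at this
      linarith
    linarith
  · intro hpos
    simp [hpos]

end IsDetector

theorem exists_recognizes_of_runs [Fintype T] {Q Γ : Type} [Finite Q] [Finite Γ]
    [DecidableEq Q] [DecidableEq Γ]
    (P : T → RTransition Q Γ → Prop) (q₀ : Q) (b : Γ) (F : Fin k → Q × Γ → Prop) :
    ∃ net : RNSRNN (Option T), net.Recognizes {w | ∀ i, ∃ p, F i p ∧
      ∃ π, List.Forall₂ P w π ∧ runEndsAt q₀ b π p.1 p.2} := by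
  let u := Fintype.equivFin T
  let e := Fintype.equivFin (T ⊕ Fin k)
  let net : RNSRNN (Option T) :=
    { Q := Q
      Γ := Γ
      finQ := Fintype.ofFinite Q
      decQ := inferInstance
      finΓ := Fintype.ofFinite Γ
      decΓ := inferInstance
      q0 := q₀
      bot := b
      dIn := Fintype.card T
      d := Fintype.card (T ⊕ Fin k)
      embed := fun x m ↦ if x = some (u.symm m) then 1 else 0
      Wi := 0
      bi := ⊤
      Wf := 0
      bf := ⊥
      Wg := fun j y ↦ (unitWeights u F (e.symm j) y : EReal)
      bg := fun _ ↦ ((0 : ℝ) : EReal)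
      Wo := 0
      bo := ⊤
      Wa := fun τ j ↦ (e.symm j).elim (fun a ↦ if P a τ then 0 else ⊥) 0
      ba := 0 }
  have hnet : net.IsDetector P F u e := by
    constructor <;> intros <;> simp [net]
  exact ⟨net, hnet.recognizes⟩

end Detector

end RNSRNN

/-- **Proposition 2.** For every finite set of context-free languages
`L₁, …, L_k` over the same finite alphabet, there exists an RNS-RNN (with
parameters allowed to take values in `ℝ ∪ {-∞, +∞}`) that recognizes the
intersection `L₁ ∩ ⋯ ∩ L_k`: after reading `w · EOS`, the MLP output `y`
satisfies `y > 1/2` iff `w ∈ L₁ ∩ ⋯ ∩ L_k`. -/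
theorem rnsrnn_recognizes_iInter_of_isContextFree {σA : Type} [Fintype σA]
    (k : ℕ) (L : Fin k → Language σA) (hL : ∀ i, (L i).IsContextFree) :
    ∃ net : RNSRNN (Option σA), net.Recognizes {w | ∀ i, w ∈ L i} := by
  choose V hV ℓ S hℓ hS using fun i ↦ (hL i).exists_isBinaryFamily
  have hfam := IsBinaryFamily.sigma hℓ
  let K := LCSymbol (Σ i, V i) k
  let S' : Fin k → Σ i, V i := fun i ↦ ⟨i, S i⟩
  let R : K → σA → List K → Prop := LCRule (fun X : Σ i, V i ↦ ℓ X.1 X.2) S'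
  let F : Fin k → K × K → Prop := fun i p ↦
    p = (LCSymbol.marker i, none) ∨ [] ∈ L i ∧ p = (none, none)
  have hset : {w | ∀ i, w ∈ L i} = {w | ∀ i, ∃ p, F i p ∧ ∃ π,
      List.Forall₂ (RTransition.IsAllowed R) w π ∧
        runEndsAt (Q := K) (Γ := K) none none π p.1 p.2} := by
    refine Set.ext fun w ↦ forall_congr' fun i ↦ ?_
    have hrun (p : K × K) := exists_runEndsAt_iff (R := R)
      (fun n a γ h ↦ LCRule.length_le h) w none none p.1 p.2
    have h := hfam.mem_iff_prefixRun S' i w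
    simp only [S', hS] at h
    rw [h]
    refine Iff.trans ?_ (exists_congr fun p ↦ and_congr_right' (hrun p).symm)
    simp only [F, or_and_right, exists_or, exists_eq_left, and_assoc, exists_and_left]
    rfl
  rw [hset]
  exact RNSRNN.exists_recognizes_of_runs (RTransition.IsAllowed R) none none F
end

section
/- For every context-free language L, there exists a restricted pushdown automaton that recognizes L; that is, real-time pushdown automata whose transitions are limited to the restricted forms (push a single symbol on top of the current top symbol, replace the top symbol, or pop the top symbol, each transition scanning exactly one input symbol) recognize all context-free languages. -/
/-- A pushdown automaton `(Q, Σ, Γ, δ, q₀, F, ⊥)` over the input alphabet `α`.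
Stacks are lists with the head as the top symbol. A transition
`(q, x, a, r, β)` may be taken when the machine is in state `q` with `x` on top
of the stack, whereupon it scans `a` (or nothing if `a = none`), moves to state
`r`, and replaces `x` by the string `β` on the stack. -/
structure PDA (α : Type) where
  /-- states -/
  Q : Type
  /-- stack alphabet -/
  Γ : Type
  [finQ : Fintype Q]
  [finΓ : Fintype Γ]
  /-- start state -/
  q0 : Q
  /-- accept states -/
  F : Set Q
  /-- bottom stack symbol -/
  bot : Γ
  /-- transitions -/
  δ : Set (Q × Γ × Option α × Q × List Γ)

attribute [instance] PDA.finQ PDA.finΓ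

namespace PDA

variable {α : Type}

/-- `P.Steps c w c'` means the PDA `P` can go from configuration `c` to
configuration `c'` while reading exactly the input string `w`. -/
inductive Steps (P : PDA α) :
    (P.Q × List P.Γ) → List α → (P.Q × List P.Γ) → Prop
  | refl (c : P.Q × List P.Γ) : Steps P c [] c
  | scan {q : P.Q} {x : P.Γ} {a : α} {r : P.Q} {β s : List P.Γ} {w : List α}
      {c : P.Q × List P.Γ} :
      (q, x, some a, r, β) ∈ P.δ → Steps P (r, β ++ s) w c →
      Steps P (q, x :: s) (a :: w) c
  | eps {q : P.Q} {x : P.Γ} {r : P.Q} {β s : List P.Γ} {w : List α}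
      {c : P.Q × List P.Γ} :
      (q, x, none, r, β) ∈ P.δ → Steps P (r, β ++ s) w c →
      Steps P (q, x :: s) w c

/-- The PDA accepts `w` iff some run reading exactly `w` from the start state
with stack `[⊥]` terminates in an accept state with `⊥` on top of the stack. -/
def Accepts (P : PDA α) (w : List α) : Prop :=
  ∃ (q : P.Q) (s : List P.Γ), q ∈ P.F ∧ P.Steps (P.q0, [P.bot]) w (q, P.bot :: s)

/-- The language recognized by the PDA. -/
def language (P : PDA α) : Language α := {w | P.Accepts w}

/-- A PDA is *restricted* if all of its transitions scan an input symbol and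
have one of the forms `(q, x, a, r, xy)` (push `y` on top of `x`),
`(q, x, a, r, y)` (replace `x` with `y`), or `(q, x, a, r, ε)` (pop `x`). -/
def Restricted (P : PDA α) : Prop :=
  ∀ t ∈ P.δ, ∃ (q : P.Q) (x : P.Γ) (a : α) (r : P.Q) (β : List P.Γ),
    t = (q, x, some a, r, β) ∧
      ((∃ y : P.Γ, β = [y, x]) ∨ (∃ y : P.Γ, β = [y]) ∨ β = [])

/-- A PDA is *almost restricted* if all of its transitions scan an input symbol
and have one of the forms `(q, x, a, r, x y₁ ⋯ y_k)` (push the string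
`y₁ ⋯ y_k` on top of `x`), `(q, x, a, r, y)` (replace `x` with `y`), or
`(q, x, a, r, ε)` (pop `x`). -/
def AlmostRestricted (P : PDA α) : Prop :=
  ∀ t ∈ P.δ, ∃ (q : P.Q) (x : P.Γ) (a : α) (r : P.Q) (β : List P.Γ),
    t = (q, x, some a, r, β) ∧
      ((∃ ys : List P.Γ, β = ys ++ [x]) ∨ (∃ y : P.Γ, β = [y]) ∨ β = [])

end PDA

/-- Leftmost derivations in Greibach form: `GreibachGen R ms w` means that the list `ms` of
nonterminals generates `w`, where `R m a l` is the rule `m → a l`. -/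
inductive GreibachGen {α M : Type} (R : M → α → List M → Prop) : List M → List α → Prop
  | nil : GreibachGen R [] []
  | cons {m : M} {a : α} {l ms : List M} {w : List α} :
      R m a l → GreibachGen R (l ++ ms) w → GreibachGen R (m :: ms) (a :: w)

namespace GreibachGen

variable {α M : Type} {R : M → α → List M → Prop}

theorem append {l ms : List M} {u v : List α} (hl : GreibachGen R l u)
    (hms : GreibachGen R ms v) : GreibachGen R (l ++ ms) (u ++ v) := by
  induction hl with
  | nil => exact hms
  | cons hr _ ih => exact .cons hr (by simpa using ih)

end GreibachGen

namespace PDA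

variable {α M : Type}

/-- The state and the replacement of the top stack symbol `x` after a Greibach rule whose
nonterminals are `l`. -/
def greibachMove : List M → Option M → Option (Option M) × List (Option M)
  | [], none => (some none, [none])
  | [], some y => (some (some y), [])
  | [y], x => (some (some y), [x])
  | y :: z :: _, x => (some (some y), [some z, x])

/-- The nonterminal to be expanded in a given state: the start state `none` expands `m₀`, and the
accepting state `some none` expands nothing. -/
def greibachGoal (m₀ : M) : Option (Option M) → Option M
  | none => some m₀
  | some g => g

/-- The automaton of a grammar in Greibach form with rules `R` and initial nonterminal `m₀`. The
leftmost nonterminal is kept in the state and the others on the stack. The proposition `e` says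
whether the empty word is accepted. -/
abbrev ofGreibach [Fintype M] (R : M → α → List M → Prop) (m₀ : M) (e : Prop) : PDA α where
  Q := Option (Option M)
  Γ := Option M
  q0 := none
  F := {q | q = some none ∨ (q = none ∧ e)}
  bot := none
  δ := {t | ∃ q m x a l, greibachGoal m₀ q = some m ∧ R m a l ∧
    t = (q, x, some a, greibachMove l x)}

/-- The configuration in which the nonterminals `ms` remain to be expanded. -/
def greibachConfig : List M → Option (Option M) × List (Option M)
  | [] => (some none, [none])
  | m :: ms => (some (some m), ms.map some ++ [none])

theorem exists_map_some_append_none_eq_cons (ms : List M) :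
    ∃ x s, ms.map some ++ [none] = x :: s := by
  cases ms <;> simp

theorem greibachMove_append {l ms : List M} (hl : l.length ≤ 2) {x : Option M}
    {s : List (Option M)} (hs : ms.map some ++ [none] = x :: s) :
    ((greibachMove l x).1, (greibachMove l x).2 ++ s) = greibachConfig (l ++ ms) := by
  match l, hl with
  | [], _ => cases ms <;> simp_all [greibachMove, greibachConfig] <;> grind [greibachMove]
  | [y], _ => simp [greibachMove, greibachConfig, hs]
  | [y, z], _ => simp [greibachMove, greibachConfig, hs]

variable [Fintype M] {R : M → α → List M → Prop} {m₀ : M} {e : Prop}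

theorem ofGreibach_restricted (hR : ∀ m a l, R m a l → l.length ≤ 2) :
    (ofGreibach R m₀ e).Restricted := by
  rintro _ ⟨q, m, x, a, l, -, hr, rfl⟩
  refine ⟨q, x, a, _, _, rfl, ?_⟩
  match l, hR _ _ _ hr, x with
  | [], _, none => exact .inr (.inl ⟨none, rfl⟩)
  | [], _, some _ => exact .inr (.inr rfl)
  | [_], _, x => exact .inr (.inl ⟨x, rfl⟩)
  | [_, z], _, _ => exact .inl ⟨some z, rfl⟩

theorem ofGreibach_steps (hR : ∀ m a l, R m a l → l.length ≤ 2) {q : Option (Option M)}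
    {m : M} (hq : greibachGoal m₀ q = some m) {ms : List M} {a : α} {l : List M} {w : List α}
    {c : Option (Option M) × List (Option M)} (hr : R m a l)
    (h : (ofGreibach R m₀ e).Steps (greibachConfig (l ++ ms)) w c) :
    (ofGreibach R m₀ e).Steps (q, ms.map some ++ [none]) (a :: w) c := by
  obtain ⟨x, s, hs⟩ := exists_map_some_append_none_eq_cons ms
  rw [← greibachMove_append (hR _ _ _ hr) hs] at h
  rw [hs]
  exact .scan ⟨q, m, x, a, l, hq, hr, rfl⟩ h

theorem ofGreibach_steps_of_gen (hR : ∀ m a l, R m a l → l.length ≤ 2) {ms : List M}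
    {w : List α} (h : GreibachGen R ms w) :
    (ofGreibach R m₀ e).Steps (greibachConfig ms) w (some none, [none]) := by
  induction h with
  | nil => exact .refl _
  | cons hr _ ih => exact ofGreibach_steps hR rfl hr ih

theorem gen_of_ofGreibach_steps (hR : ∀ m a l, R m a l → l.length ≤ 2)
    {c c' : (ofGreibach R m₀ e).Q × List (ofGreibach R m₀ e).Γ} {w : List α}
    (h : (ofGreibach R m₀ e).Steps c w c') (hc' : c'.1 ∈ (ofGreibach R m₀ e).F) :
    ∀ q ms m, c = (q, ms.map some ++ [none]) → greibachGoal m₀ q = some m →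
      (w = [] ∧ q = none ∧ e) ∨ GreibachGen R (m :: ms) w := by
  induction h with
  | refl c =>
    rintro q ms m rfl hq
    rcases hc' with h | h
    · obtain rfl : q = some none := h
      simp [greibachGoal] at hq
    · exact .inl ⟨rfl, h⟩
  | @scan q x a r β s w c hδ hsteps ih =>
    rintro q' ms m hc hq
    obtain ⟨rfl, hs⟩ := Prod.mk.inj hc
    obtain ⟨q₁, m₁, x₁, a₁, l, hq₁, hr, ht⟩ := hδ
    simp only [Prod.mk.injEq, Option.some.injEq] at ht
    obtain ⟨rfl, rfl, rfl, hrβ⟩ := ht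
    obtain rfl : m₁ = m := Option.some.inj (hq₁.symm.trans hq)
    have hmove := greibachMove_append (hR _ _ _ hr) hs.symm
    rw [← hrβ] at hmove
    refine .inr (.cons hr ?_)
    cases hl : l ++ ms with
    | nil =>
      rw [hl] at hmove
      have hend : (ofGreibach R m₀ e).Steps (some none, [none]) w c := by
        rw [hmove] at hsteps
        exact hsteps
      cases hend with
      | refl => exact .nil
      | scan hδ _ =>
        obtain ⟨q₁, m₁, x₁, a₁, l, hq₁, hr, ht⟩ := hδ
        obtain rfl : some none = q₁ := congrArg Prod.fst ht
        simp [greibachGoal] at hq₁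
      | eps hδ _ =>
        obtain ⟨q₁, m₁, x₁, a₁, l, hq₁, hr, ht⟩ := hδ
        simp at ht
    | cons m' ms' =>
      rw [hl] at hmove
      refine (ih hc' (some (some m')) ms' m' hmove rfl).resolve_left ?_
      simp
  | eps hδ _ _ =>
    obtain ⟨q₁, m₁, x₁, a₁, l, hq₁, hr, ht⟩ := hδ
    simp at ht

theorem mem_ofGreibach_language (hR : ∀ m a l, R m a l → l.length ≤ 2) {w : List α} :
    w ∈ (ofGreibach R m₀ e).language ↔ (w = [] ∧ e) ∨ GreibachGen R [m₀] w := by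
  constructor
  · rintro ⟨q, s, hq, hs⟩
    have := gen_of_ofGreibach_steps hR hs hq none [] m₀ rfl rfl
    tauto
  · rintro (⟨rfl, he⟩ | h)
    · exact ⟨none, [], .inr ⟨rfl, he⟩, .refl _⟩
    · cases h with
      | cons hr h =>
        exact ⟨some none, [], .inl rfl,
          ofGreibach_steps (ms := []) hR (m := m₀) rfl hr (ofGreibach_steps_of_gen hR h)⟩

end PDA

namespace LeftCorner

variable {α N : Type}

/-- The list consisting of the left-corner nonterminal `A / X`, which may be left out if
`A = X`. -/
def Slash (A X : N) (l : List (Option (N × N))) : Prop :=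
  l = [some (A, X)] ∨ (A = X ∧ l = [])

/-- The rules of the left-corner transform of a grammar with binary rules `bin`, nonterminal
languages `D` and initial nonterminal `S`. The nonterminal `some (A, X)` generates what is missing
to complete an `X` to an `A`, and `none` is the initial nonterminal. -/
def Rule (bin : N → N → N → Prop) (D : N → List α → Prop) (S : N) :
    Option (N × N) → α → List (Option (N × N)) → Prop
  | none, b, l => ∃ Z, D Z [b] ∧ Slash S Z l
  | some (A, X), b, l => ∃ Z Y Z' l₁ l₂, bin Z X Y ∧ D Z' [b] ∧ Slash Y Z' l₁ ∧ Slash A Z l₂ ∧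
      l = l₁ ++ l₂

/-- The language of a nonterminal of the left-corner transform. -/
def Sem (D : N → List α → Prop) (S : N) : Option (N × N) → List α → Prop
  | none, w => D S w
  | some (A, X), w => ∀ x, D X x → D A (x ++ w)

/-- The language of a list of nonterminals of the left-corner transform. -/
def SemList (D : N → List α → Prop) (S : N) : List (Option (N × N)) → List α → Prop
  | [], w => w = []
  | m :: ms, w => ∃ u v, w = u ++ v ∧ Sem D S m u ∧ SemList D S ms v

variable {bin : N → N → N → Prop} {D : N → List α → Prop} {S : N}

theorem Slash.length_le {A X : N} {l : List (Option (N × N))} (h : Slash A X l) :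
    l.length ≤ 1 := by
  rcases h with rfl | ⟨-, rfl⟩ <;> simp

theorem Rule.length_le (m : Option (N × N)) (a : α) (l : List (Option (N × N)))
    (h : Rule bin D S m a l) : l.length ≤ 2 := by
  match m, h with
  | none, ⟨_, _, h⟩ => exact h.length_le.trans one_le_two
  | some _, ⟨_, _, _, _, _, _, _, h₁, h₂, hl⟩ =>
    have := h₁.length_le
    have := h₂.length_le
    grind

theorem Slash.exists_of_semList_append {A X : N} {l ms : List (Option (N × N))} {w : List α}
    (h : Slash A X l) (hw : SemList D S (l ++ ms) w) :
    ∃ u v, w = u ++ v ∧ (∀ x, D X x → D A (x ++ u)) ∧ SemList D S ms v := by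
  rcases h with rfl | ⟨rfl, rfl⟩
  · exact hw
  · exact ⟨[], w, rfl, by simp, hw⟩

theorem semList_of_gen (hbin : ∀ Z X Y u v, bin Z X Y → D X u → D Y v → D Z (u ++ v))
    {ms : List (Option (N × N))} {w : List α} (h : GreibachGen (Rule bin D S) ms w) :
    SemList D S ms w := by
  induction h with
  | nil => rfl
  | @cons m a l ms w hr _ ih =>
    match m, hr with
    | none, ⟨Z, hZ, hl⟩ =>
      obtain ⟨u, v, rfl, hu, hv⟩ := hl.exists_of_semList_append ih
      exact ⟨a :: u, v, rfl, hu _ hZ, hv⟩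
    | some (A, X), ⟨Z, Y, Z', l₁, l₂, hZ, ha, h₁, h₂, hl⟩ =>
      subst hl
      rw [List.append_assoc] at ih
      obtain ⟨u₁, v₁, rfl, hu₁, hv₁⟩ := h₁.exists_of_semList_append ih
      obtain ⟨u₂, v₂, rfl, hu₂, hv₂⟩ := h₂.exists_of_semList_append hv₁
      refine ⟨a :: u₁ ++ u₂, v₂, by simp, fun x hx => ?_, hv₂⟩
      simpa using hu₂ _ (hbin _ _ _ _ _ hZ hx (hu₁ _ ha))

/-- A word of `X` starts with the left corner `Z`, and whatever completes an `X` to an `A`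
extends the rest of the word to a completion of `Z` to an `A`. -/
theorem exists_leftCorner
    (hdec : ∀ Z w, D Z w → 2 ≤ w.length →
      ∃ X Y u v, bin Z X Y ∧ D X u ∧ D Y v ∧ u ≠ [] ∧ v ≠ [] ∧ w = u ++ v)
    (n : ℕ) (w : List α) (hn : w.length ≤ n) (X : N) (hX : D X w) (hw : w ≠ []) :
    ∃ Z a u, w = a :: u ∧ D Z [a] ∧ ∀ A v lA, Slash A X lA →
      GreibachGen (Rule bin D S) lA v →
        ∃ l, Slash A Z l ∧ GreibachGen (Rule bin D S) l (u ++ v) := by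
  induction n generalizing w X with
  | zero => simp_all
  | succ n ih =>
    match w, hw with
    | [a], _ => exact ⟨X, a, [], rfl, hX, fun A v lA hA hv => ⟨lA, hA, hv⟩⟩
    | a :: b :: w', _ =>
      obtain ⟨X₁, Y, u₁, v₁, hb, hu, hv, hu₀, hv₀, hw⟩ := hdec X _ hX (by simp)
      have hlen := congrArg List.length hw
      have := List.length_pos_iff.2 hu₀
      have := List.length_pos_iff.2 hv₀
      rw [List.length_append] at hlen
      obtain ⟨Z, c, u, rfl, hZ, hcont⟩ := ih u₁ (by omega) X₁ hu hu₀
      obtain ⟨Z', d, u', rfl, hZ', hcont'⟩ := ih v₁ (by omega) Y hv hv₀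
      obtain ⟨l', hl', hgen'⟩ := hcont' Y [] [] (.inr ⟨rfl, rfl⟩) .nil
      refine ⟨Z, c, u ++ d :: u', by simpa using hw, hZ, fun A v lA hA hgen => ?_⟩
      obtain ⟨l, hl, hgenl⟩ := hcont A (d :: (u' ++ v)) [some (A, X₁)] (.inl rfl)
        (.cons (l := l' ++ lA) ⟨X, Y, Z', l', lA, hb, hZ', hl', hA, rfl⟩
          (by simpa using hgen'.append hgen))
      exact ⟨l, hl, by simpa using hgenl⟩

theorem gen_iff (hbin : ∀ Z X Y u v, bin Z X Y → D X u → D Y v → D Z (u ++ v))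
    (hdec : ∀ Z w, D Z w → 2 ≤ w.length →
      ∃ X Y u v, bin Z X Y ∧ D X u ∧ D Y v ∧ u ≠ [] ∧ v ≠ [] ∧ w = u ++ v) {w : List α} :
    GreibachGen (Rule bin D S) [none] w ↔ D S w ∧ w ≠ [] := by
  constructor
  · intro h
    refine ⟨?_, by rintro rfl; cases h⟩
    obtain ⟨u, v, rfl, hu, rfl⟩ := semList_of_gen hbin h
    simpa [Sem] using hu
  · rintro ⟨hS, hw⟩
    obtain ⟨Z, a, u, rfl, hZ, hcont⟩ := exists_leftCorner hdec _ w le_rfl S hS hw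
    obtain ⟨l, hl, hgen⟩ := hcont S [] [] (.inr ⟨rfl, rfl⟩) .nil
    exact .cons ⟨Z, hZ, hl⟩ (by simpa using hgen)

end LeftCorner

namespace ContextFreeGrammar

variable {α : Type} {g : ContextFreeGrammar α}

/-- `g.Yields s w` means that there is a parse forest of `w` with roots `s`. -/
inductive Yields_s6 (g : ContextFreeGrammar α) : List (Symbol α g.NT) → List α → Prop
  | nil : Yields_s6 g [] []
  | terminal (a : α) {s : List (Symbol α g.NT)} {w : List α} :
      Yields_s6 g s w → Yields_s6 g (.terminal a :: s) (a :: w)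
  | nonterminal {r : ContextFreeRule α g.NT} {s : List (Symbol α g.NT)} {u v : List α} :
      r ∈ g.rules → Yields_s6 g r.output u → Yields_s6 g s v →
        Yields_s6 g (.nonterminal r.input :: s) (u ++ v)

theorem Derives.append {s s' t t' : List (Symbol α g.NT)} (h : g.Derives s s')
    (h' : g.Derives t t') : g.Derives (s ++ t) (s' ++ t') :=
  (h.append_right t).trans (h'.append_left s')

theorem derives_output {r : ContextFreeRule α g.NT} (hr : r ∈ g.rules) :
    g.Derives [.nonterminal r.input] r.output :=
  .single ⟨r, hr, ContextFreeRule.Rewrites.input_output⟩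

theorem Yields_s6.derives {s : List (Symbol α g.NT)} {w : List α} (h : g.Yields_s6 s w) :
    g.Derives s (w.map .terminal) := by
  induction h with
  | nil => exact .refl _
  | terminal a _ ih => exact ih.append_left [.terminal a]
  | nonterminal hr _ _ ihu ihv =>
    rw [List.map_append]
    exact ((derives_output hr).trans ihu).append ihv

theorem Yields_s6.append {s t : List (Symbol α g.NT)} {u v : List α} (hs : g.Yields_s6 s u)
    (ht : g.Yields_s6 t v) : g.Yields_s6 (s ++ t) (u ++ v) := by
  induction hs with
  | nil => exact ht
  | terminal a _ ih => exact .terminal a ih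
  | nonterminal hr hu _ _ ih =>
    rw [List.append_assoc]
    exact .nonterminal hr hu ih

theorem Yields_s6.exists_of_append {s t : List (Symbol α g.NT)} {w : List α}
    (h : g.Yields_s6 (s ++ t) w) : ∃ u v, w = u ++ v ∧ g.Yields_s6 s u ∧ g.Yields_s6 t v := by
  induction s generalizing w with
  | nil => exact ⟨[], w, rfl, .nil, h⟩
  | cons x s ih =>
    cases h with
    | terminal a h =>
      obtain ⟨u, v, rfl, hu, hv⟩ := ih h
      exact ⟨a :: u, v, rfl, .terminal a hu, hv⟩
    | nonterminal hr hout h =>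
      obtain ⟨u, v, rfl, hu, hv⟩ := ih h
      exact ⟨_, v, (List.append_assoc ..).symm, .nonterminal hr hout hu, hv⟩

theorem yields_map_terminal (w : List α) : g.Yields_s6 (w.map .terminal) w := by
  induction w with
  | nil => exact .nil
  | cons a w ih => exact .terminal a ih

theorem yields_iff_derives_s6 {s : List (Symbol α g.NT)} {w : List α} :
    g.Yields_s6 s w ↔ g.Derives s (w.map .terminal) := by
  refine ⟨Yields_s6.derives, fun h => ?_⟩
  induction h using Relation.ReflTransGen.head_induction_on with
  | refl => exact yields_map_terminal w
  | head hprod _ ih =>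
    obtain ⟨r, hr, hrw⟩ := hprod
    obtain ⟨p, q, rfl, rfl⟩ := hrw.exists_parts
    obtain ⟨u', v, rfl, hu', hv⟩ := ih.exists_of_append
    obtain ⟨t, u, rfl, ht, hu⟩ := hu'.exists_of_append
    refine (ht.append ?_).append hv
    simpa using Yields_s6.nonterminal hr hu .nil

/-- The sublists of the right-hand sides of rules and of the initial string. -/
def ruleSublists (g : ContextFreeGrammar α) : Set (List (Symbol α g.NT)) :=
  {s | s.Sublist [.nonterminal g.initial] ∨ ∃ r ∈ g.rules, s.Sublist r.output}

theorem finite_ruleSublists (g : ContextFreeGrammar α) : g.ruleSublists.Finite := by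
  have hfin (b : List (Symbol α g.NT)) : {s : List (Symbol α g.NT) | s.Sublist b}.Finite := by
    simpa using b.sublists.finite_toSet
  refine (hfin _).union ((g.rules.finite_toSet.biUnion fun r _ => hfin r.output).subset ?_)
  rintro s ⟨r, hr, hs⟩
  exact Set.mem_biUnion hr hs

theorem mem_ruleSublists_of_sublist {s t : List (Symbol α g.NT)} (hst : s.Sublist t)
    (ht : t ∈ g.ruleSublists) : s ∈ g.ruleSublists := by
  rcases ht with h | ⟨r, hr, h⟩
  · exact .inl (hst.trans h)
  · exact .inr ⟨r, hr, hst.trans h⟩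

theorem Yields_s6.exists_binary {s : List (Symbol α g.NT)} {w : List α} (h : g.Yields_s6 s w)
    (hs : s ∈ g.ruleSublists) (hw : 2 ≤ w.length) :
    ∃ x ∈ g.ruleSublists, ∃ y ∈ g.ruleSublists, ∃ u v, g.Derives s (x ++ y) ∧
      g.Yields_s6 x u ∧ g.Yields_s6 y v ∧ u ≠ [] ∧ v ≠ [] ∧ w = u ++ v := by
  induction h with
  | nil => simp at hw
  | @terminal a s w h _ =>
    refine ⟨[.terminal a], mem_ruleSublists_of_sublist (by simp) hs, s,
      mem_ruleSublists_of_sublist (by simp) hs, [a], w, .refl _, .terminal a .nil, h, by simp, ?_,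
      rfl⟩
    rintro rfl
    simp at hw
  | @nonterminal r s u v hr hu hv ihu ihv =>
    have hmem : s ∈ g.ruleSublists := mem_ruleSublists_of_sublist (by simp) hs
    rcases eq_or_ne u [] with rfl | hu₀
    · obtain ⟨x, hx, y, hy, u', v', hd, h⟩ := ihv hmem hw
      exact ⟨x, hx, y, hy, u', v',
        (((derives_output hr).trans hu.derives).append_right s).trans hd, h⟩
    rcases eq_or_ne v [] with rfl | hv₀
    · rw [List.append_nil] at hw ⊢
      obtain ⟨x, hx, y, hy, u', v', hd, h⟩ := ihu (.inr ⟨r, hr, .refl _⟩) hw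
      refine ⟨x, hx, y, hy, u', v', ?_, h⟩
      simpa using ((derives_output hr).trans hd).append hv.derives
    · exact ⟨[.nonterminal r.input], mem_ruleSublists_of_sublist (by simp) hs, s, hmem, u, v,
        .refl _, by simpa using Yields_s6.nonterminal hr hu .nil, hv, hu₀, hv₀, rfl⟩

end ContextFreeGrammar

/-- **Theorem.** For every context-free language `L`, there exists a restricted
pushdown automaton that recognizes `L`: real-time PDAs whose transitions are
limited to the restricted forms (push a single symbol on top of the current top
symbol, replace the top symbol, or pop the top symbol, each transition scanning
exactly one input symbol) recognize all context-free languages. -/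
theorem exists_restricted_pda_of_isContextFree {α : Type} (L : Language α)
    (hL : L.IsContextFree) :
    ∃ P : PDA α, P.Restricted ∧ P.language = L := by
  obtain ⟨g, rfl⟩ := hL
  let N := g.ruleSublists
  have : Fintype N := g.finite_ruleSublists.fintype
  let D : N → List α → Prop := fun s w => g.Yields_s6 s w
  let bin : N → N → N → Prop := fun z x y => g.Derives z (x ++ y : List (Symbol α g.NT))
  let S : N := ⟨[.nonterminal g.initial], .inl (.refl _)⟩
  have hbin : ∀ Z X Y u v, bin Z X Y → D X u → D Y v → D Z (u ++ v) := by
    intro Z X Y u v hZ hX hY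
    refine ContextFreeGrammar.yields_iff_derives_s6.2 (hZ.trans ?_)
    rw [List.map_append]
    exact hX.derives.append hY.derives
  have hdec : ∀ Z w, D Z w → 2 ≤ w.length →
      ∃ X Y u v, bin Z X Y ∧ D X u ∧ D Y v ∧ u ≠ [] ∧ v ≠ [] ∧ w = u ++ v := by
    intro Z w hZ hw
    obtain ⟨x, hx, y, hy, h⟩ := hZ.exists_binary Z.2 hw
    exact ⟨⟨x, hx⟩, ⟨y, hy⟩, h⟩
  have hlen := LeftCorner.Rule.length_le (bin := bin) (D := D) (S := S)
  refine ⟨PDA.ofGreibach (LeftCorner.Rule bin D S) none (D S []),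
    PDA.ofGreibach_restricted hlen, ?_⟩
  ext w
  rw [PDA.mem_ofGreibach_language hlen, LeftCorner.gen_iff hbin hdec,
    ContextFreeGrammar.mem_language_iff, ← ContextFreeGrammar.yields_iff_derives_s6]
  change _ ↔ D S w
  rcases eq_or_ne w [] with rfl | hw <;> simp_all
end
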